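/- (No variance reduction on typical sets for classical i.i.d. tilted IS in the Gaussian case.) Let U_1,...,U_n be i.i.d. standard normal, a > 0, and consider importance sampling with sampling density the n-fold product of N(a,1). Let V := E_{P}[ 1_{(a,∞)}(U_{1,n}/n) exp(na²/2) exp(−a U_{1,n}) ] − P_n², P_n := P(U_{1,n}/n > a), be the variance term of the IS estimate, and for b = b_n define MSE((b,∞)) := E_P[ 1_{(a,∞)∩(b,∞)}(U_{1,n}/n) exp(na²/2) exp(−a U_{1,n}) ] − P_n². Then there is no sequence b_n such that both (a) lim_{n→∞} Π^a( U_{1,n}/n > b_n ) = 1 under the tilted product law Π^a = N(a,1)^{⊗n}, and (b) limsup_{n→∞} MSE((b_n,∞))/V < 1: when b_n ≤ a condition (b) fails, and when b_n > a condition (a) fails. -/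

import Mathlib

open MeasureTheory ProbabilityTheory Real Filter Topology

noncomputable section

/-- The variance term of the classical i.i.d. tilted IS estimate in the Gaussian case,
restricted to the set `(b,∞)` for the normalized sum:
`E_P[1_{(a,∞)∩(b,∞)}(U_{1,n}/n) exp(na²/2) exp(-a U_{1,n})] - P_n²`. -/
def gaussMSE (n : ℕ) (a b : ℝ) : ℝ :=
  (∫ y in {y : Fin n → ℝ | a < (∑ i, y i) / n ∧ b < (∑ i, y i) / n},
      Real.exp ((n : ℝ) * a ^ 2 / 2) * Real.exp (-(a * ∑ i, y i))
    ∂(Measure.pi fun _ : Fin n => gaussianReal 0 1)) -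
  ((Measure.pi fun _ : Fin n => gaussianReal 0 1)
      {y : Fin n → ℝ | a < (∑ i, y i) / n}).toReal ^ 2

/-- A strict Cauchy–Schwarz inequality for a likelihood ratio `h` with inverse `g`. -/
lemma sq_measureReal_lt_setIntegral_of_mul_eq_one {α : Type*} [MeasurableSpace α]
    {μ : Measure α} [IsFiniteMeasure μ] {g h : α → ℝ} {s : Set α}
    (hg : Integrable g μ) (hh : Integrable h μ) (hpos : ∀ y, 0 < h y)
    (hgh : ∀ y, g y * h y = 1) (hint : ∫ y, h y ∂μ ≤ 1) (hs : MeasurableSet s)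
    (hμs : μ s ≠ 0) (hμsc : μ sᶜ ≠ 0) :
    μ.real s ^ 2 < ∫ y in s, g y ∂μ := by
  set p := μ.real s with hp
  have hp0 : 0 < p := ENNReal.toReal_pos hμs (measure_ne_top μ s)
  have hsc : 0 < ∫ y in sᶜ, h y ∂μ := by
    rw [setIntegral_pos_iff_support_of_nonneg_ae (ae_of_all _ fun y => (hpos y).le)
      hh.integrableOn]
    have hsupp : Function.support h = Set.univ :=
      Set.eq_univ_of_forall fun y => (hpos y).ne'
    rw [hsupp, Set.univ_inter]
    exact pos_iff_ne_zero.mpr hμsc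
  have hadd := integral_add_compl hs hh
  have hmono : ∫ y in s, (2 * p - p ^ 2 * h y) ∂μ ≤ ∫ y in s, g y ∂μ := by
    refine integral_mono ((integrable_const _).sub (hh.integrableOn.const_mul _))
      hg.integrableOn fun y => ?_
    have hsq : 0 ≤ h y * (g y - p) ^ 2 := mul_nonneg (hpos y).le (sq_nonneg _)
    have hexp : h y * (g y - p) ^ 2 = g y - 2 * p + p ^ 2 * h y := by
      linear_combination (g y - 2 * p) * hgh y
    simp only
    linarith
  rw [integral_sub (integrable_const _) (hh.integrableOn.const_mul _), integral_const,
    integral_const_mul, smul_eq_mul, measureReal_restrict_apply_univ, ← hp] at hmono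
  nlinarith [mul_pos (pow_pos hp0 2) hsc]

lemma integrable_exp_mul_sum_gaussian (n : ℕ) (t : ℝ) :
    Integrable (fun y : Fin n → ℝ => Real.exp (t * ∑ i, y i))
      (Measure.pi fun _ : Fin n => gaussianReal 0 1) := by
  simp_rw [Finset.mul_sum, Real.exp_sum]
  exact Integrable.fintype_prod (f := fun _ x => Real.exp (t * x))
    fun _ => integrable_exp_mul_gaussianReal t

lemma integral_exp_mul_sum_gaussian (n : ℕ) (t : ℝ) :
    ∫ y : Fin n → ℝ, Real.exp (t * ∑ i, y i) ∂(Measure.pi fun _ : Fin n => gaussianReal 0 1)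
      = Real.exp (n * t ^ 2 / 2) := by
  have hmgf : ∫ x, Real.exp (t * x) ∂(gaussianReal 0 1) = Real.exp (t ^ 2 / 2) := by
    have h := congrFun (mgf_id_gaussianReal (μ := 0) (v := 1)) t
    simpa [mgf] using h
  simp_rw [Finset.mul_sum, Real.exp_sum]
  rw [integral_fintype_prod_eq_prod (f := fun (_ : Fin n) x => Real.exp (t * x))]
  simp only [hmgf, Finset.prod_const, Finset.card_univ, Fintype.card_fin]
  rw [← Real.exp_nat_mul, mul_div_assoc]

instance isOpenPosMeasure_gaussianReal_one (μ : ℝ) :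
    (gaussianReal μ 1).IsOpenPosMeasure :=
  (gaussianReal_absolutelyContinuous' μ one_ne_zero).isOpenPosMeasure

lemma measurableSet_lt_mean (n : ℕ) (c : ℝ) :
    MeasurableSet {y : Fin n → ℝ | c < (∑ i, y i) / n} :=
  measurableSet_lt measurable_const (by fun_prop)

lemma gaussMSE_self_pos {n : ℕ} (hn : n ≠ 0) {a : ℝ} (ha : 0 < a) : 0 < gaussMSE n a a := by
  have hn' : (n : ℝ) ≠ 0 := Nat.cast_ne_zero.mpr hn
  have hcont : Continuous fun y : Fin n → ℝ => (∑ i, y i) / n := by fun_prop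
  unfold gaussMSE
  simp only [and_self]
  rw [sub_pos]
  refine sq_measureReal_lt_setIntegral_of_mul_eq_one
    (h := fun y : Fin n → ℝ => Real.exp (-(n * a ^ 2 / 2)) * Real.exp (a * ∑ i, y i))
    ?_ ?_ (fun y => by positivity) (fun y => ?_) ?_ (measurableSet_lt_mean n a) ?_ ?_
  · simp_rw [← neg_mul]
    exact (integrable_exp_mul_sum_gaussian n (-a)).const_mul _
  · exact (integrable_exp_mul_sum_gaussian n a).const_mul _
  · rw [← Real.exp_add, ← Real.exp_add, ← Real.exp_add, Real.exp_eq_one_iff]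
    ring
  · rw [integral_const_mul, integral_exp_mul_sum_gaussian, ← Real.exp_add, neg_add_cancel,
      Real.exp_zero]
  · refine (isOpen_lt continuous_const hcont).measure_ne_zero _ ⟨fun _ => a + 1, ?_⟩
    simp only [Set.mem_ofPred_eq, Finset.sum_const, Finset.card_univ, Fintype.card_fin,
      nsmul_eq_mul, mul_div_cancel_left₀ _ hn']
    linarith
  · refine ne_of_gt (lt_of_lt_of_le
      ((isOpen_lt hcont continuous_const).measure_pos _ ⟨fun _ => 0, ?_⟩)
      (measure_mono fun y (hy : _ < a) => not_lt.mpr hy.le))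
    simpa using ha

lemma gaussMSE_le_self (n : ℕ) (a b : ℝ) : gaussMSE n a b ≤ gaussMSE n a a := by
  unfold gaussMSE
  refine sub_le_sub_right (setIntegral_mono_set (Integrable.integrableOn ?_)
    (ae_of_all _ fun y => by positivity)
    (ae_of_all _ fun y hy => ⟨hy.1, hy.1⟩)) _
  simp_rw [← neg_mul]
  exact (integrable_exp_mul_sum_gaussian n (-a)).const_mul _

lemma gaussMSE_eq_self {n : ℕ} {a b : ℝ} (hb : b ≤ a) : gaussMSE n a b = gaussMSE n a a := by
  have hset : {y : Fin n → ℝ | a < (∑ i, y i) / n ∧ b < (∑ i, y i) / n} =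
      {y : Fin n → ℝ | a < (∑ i, y i) / n ∧ a < (∑ i, y i) / n} := by
    ext y
    exact ⟨fun h => ⟨h.1, h.1⟩, fun h => ⟨h.1, hb.trans_lt h.1⟩⟩
  unfold gaussMSE
  rw [hset]

lemma not_limsup_lt_one_of_frequently_le {a : ℝ} (ha : 0 < a) {b : ℕ → ℝ}
    (hb : ∃ᶠ n : ℕ in atTop, b n ≤ a) :
    ¬ Filter.limsup (fun n => gaussMSE n a (b n) / gaussMSE n a a) atTop < 1 := by
  rw [not_lt]
  refine le_limsup_of_frequently_le ?_ ?_
  · refine (hb.and_eventually (eventually_ne_atTop 0)).mono fun n hn => ?_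
    rw [gaussMSE_eq_self hn.1, div_self (gaussMSE_self_pos hn.2 ha).ne']
  · refine isBoundedUnder_of_eventually_le (a := 1) ?_
    filter_upwards [eventually_ne_atTop 0] with n hn
    exact (div_le_one (gaussMSE_self_pos hn ha)).mpr (gaussMSE_le_self n a (b n))

/-- By symmetry about its mean, a Gaussian sample mean exceeds its expectation with probability
at most one half. -/
lemma measure_lt_mean_le_half {n : ℕ} (hn : n ≠ 0) (a : ℝ) :
    (Measure.pi fun _ : Fin n => gaussianReal a 1) {y : Fin n → ℝ | a < (∑ i, y i) / n}
      ≤ 1 / 2 := by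
  have hn' : (n : ℝ) ≠ 0 := Nat.cast_ne_zero.mpr hn
  set Q := Measure.pi fun _ : Fin n => gaussianReal a 1
  set s := {y : Fin n → ℝ | a < (∑ i, y i) / n}
  have hs : MeasurableSet s := measurableSet_lt_mean n a
  have hmp : MeasurePreserving (fun (y : Fin n → ℝ) i => 2 * a - y i) Q Q := by
    refine measurePreserving_pi _ _ fun _ => ⟨by fun_prop, ?_⟩
    rw [gaussianReal_map_const_sub]
    ring_nf
  have hpre := hmp.measure_preimage hs.nullMeasurableSet
  have hdisj : Disjoint s ((fun (y : Fin n → ℝ) i => 2 * a - y i) ⁻¹' s) := by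
    rw [Set.disjoint_left]
    intro y (hy : a < _) (hy' : a < _)
    rw [Finset.sum_sub_distrib, Finset.sum_const, Finset.card_univ, Fintype.card_fin,
      nsmul_eq_mul, sub_div, mul_div_cancel_left₀ _ hn'] at hy'
    linarith
  have hle : Q s + Q s ≤ 1 := by
    nth_rewrite 2 [← hpre]
    rw [← measure_union hdisj (hmp.measurable hs)]
    exact prob_le_one
  rw [ENNReal.le_div_iff_mul_le (by simp) (by simp), mul_two]
  exact hle

lemma not_tendsto_measure_lt_mean_one (a : ℝ) {b : ℕ → ℝ}
    (hb : ∀ᶠ n : ℕ in atTop, a < b n) :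
    ¬ Tendsto (fun n =>
        (Measure.pi fun _ : Fin n => gaussianReal a 1)
          {y : Fin n → ℝ | b n < (∑ i, y i) / n}) atTop (𝓝 1) := by
  intro h
  have hle : (1 : ENNReal) ≤ 1 / 2 := by
    refine le_of_tendsto h ?_
    filter_upwards [hb, eventually_ne_atTop 0] with n hbn hn
    exact (measure_mono fun y (hy : b n < _) => hbn.trans hy).trans (measure_lt_mean_le_half hn a)
  rw [one_div] at hle
  exact absurd hle (not_le.mpr ENNReal.one_half_lt_one)

/-- **No variance reduction on typical sets for classical i.i.d. tilted IS (Gaussian case)**: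
with `U_1,…,U_n` i.i.d. standard normal, `a > 0`, tilted sampling density `N(a,1)^{⊗n}`,
variance term `V = E_P[1_{(a,∞)}(U_{1,n}/n) e^{na²/2} e^{-a U_{1,n}}] - P_n²` and
`MSE((b,∞)) = E_P[1_{(a,∞)∩(b,∞)}(U_{1,n}/n) e^{na²/2} e^{-a U_{1,n}}] - P_n²`, there is no
sequence `b_n` with both (a) `Π^a(U_{1,n}/n > b_n) → 1` and (b) `limsup MSE((b_n,∞))/V < 1`;
indeed when `b_n ≤ a` condition (b) fails, and when `b_n > a` condition (a) fails. -/
theorem no_variance_reduction_gaussian (a : ℝ) (ha : 0 < a) :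
    (∀ b : ℕ → ℝ,
      ¬ (Tendsto (fun n =>
            (Measure.pi fun _ : Fin n => gaussianReal a 1)
              {y : Fin n → ℝ | b n < (∑ i, y i) / n}) atTop (𝓝 1)
          ∧ Filter.limsup (fun n => gaussMSE n a (b n) / gaussMSE n a a) atTop < 1))
    ∧
    (∀ b : ℕ → ℝ, (∀ᶠ n : ℕ in atTop, b n ≤ a) →
      ¬ Filter.limsup (fun n => gaussMSE n a (b n) / gaussMSE n a a) atTop < 1)
    ∧
    (∀ b : ℕ → ℝ, (∀ᶠ n : ℕ in atTop, a < b n) →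
      ¬ Tendsto (fun n =>
          (Measure.pi fun _ : Fin n => gaussianReal a 1)
            {y : Fin n → ℝ | b n < (∑ i, y i) / n}) atTop (𝓝 1)) := by
  refine ⟨fun b h => ?_, fun b hb => not_limsup_lt_one_of_frequently_le ha hb.frequently,
    fun b hb => not_tendsto_measure_lt_mean_one a hb⟩
  by_cases hb : ∃ᶠ n : ℕ in atTop, b n ≤ a
  · exact not_limsup_lt_one_of_frequently_le ha hb h.2
  · refine not_tendsto_measure_lt_mean_one a ?_ h.1
    simpa only [not_frequently, not_le] using hb
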